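/- Let h be an invertible (n+1)×(n+1) complex matrix with h*J₀h = J₀. Suppose h·e₀ is a scalar multiple of eₙ and h·eₙ is a scalar multiple of e₀ (i.e. h swaps the cusps q_∞ = [e₀] and q₀ = [eₙ] projectively). Then every entry of h outside the (0,n) entry, the (n,0) entry, and the middle (n−1)×(n−1) block A = (h(i,j))_{0<i,j<n} vanishes; the middle block satisfies A*A = I_{n−1}; and h(0,n) = 1/conj(h(n,0)). -/

import Mathlib

open Matrix Complex

/-- The matrix `J₀` of the Hermitian form of signature `(n,1)` in the Siegel-domain model. -/
noncomputable def J0 (n : ℕ) : Matrix (Fin (n+1)) (Fin (n+1)) ℂ :=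
  Matrix.of fun i j =>
    if i.val = 0 ∧ j.val = n then 1
    else if i.val = n ∧ j.val = 0 then 1
    else if i = j ∧ 0 < i.val ∧ i.val < n then 1
    else 0

/-- Extend a vector `ζ ∈ ℂ^{n-1}` to the middle coordinates `1,…,n-1` of `ℂ^{n+1}`. -/
noncomputable def pad (n : ℕ) (ζ : Fin (n-1) → ℂ) (i : Fin (n+1)) : ℂ :=
  if h : 0 < i.val ∧ i.val < n then ζ ⟨i.val - 1, by omega⟩ else 0

/-- The embedding `ψ` of the Siegel domain (horospherical coordinates) into `ℂ^{n+1}`: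
`ψ(ζ,v,u)` has 0-th coordinate `(−‖ζ‖² − u + iv)/2`, middle coordinates `ζ`,
and last coordinate `1`. -/
noncomputable def psi (n : ℕ) (ζ : Fin (n-1) → ℂ) (v u : ℝ) : Fin (n+1) → ℂ :=
  fun i =>
    if i.val = 0 then (((-(∑ j, Complex.normSq (ζ j)) - u : ℝ) : ℂ) + (v : ℂ) * Complex.I) / 2
    else if i.val = n then 1
    else pad n ζ i

/-- The standard basis vector `e₀ = (1,0,…,0)ᵀ` of `ℂ^{n+1}`. -/
noncomputable def e0 (n : ℕ) : Fin (n+1) → ℂ := Pi.single 0 1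

/-- The standard basis vector `eₙ = (0,…,0,1)ᵀ` of `ℂ^{n+1}`. -/
noncomputable def eLast (n : ℕ) : Fin (n+1) → ℂ := Pi.single (Fin.last n) 1

/-- The inclusion of an index of `ℂ^{n-1}` into the middle indices `1,…,n-1` of `ℂ^{n+1}`. -/
def midIdx (n : ℕ) (i : Fin (n-1)) : Fin (n+1) := ⟨i.val + 1, by have := i.isLt; omega⟩

/-- The sesquilinear form of `J₀`, evaluated on two columns of a matrix. -/
theorem conjTranspose_mul_J0_mul_apply (m : ℕ) (h : Matrix (Fin (m+1+1)) (Fin (m+1+1)) ℂ)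
    (i j : Fin (m+1+1)) :
    (hᴴ * J0 (m+1) * h) i j =
      star (h (Fin.last (m+1)) i) * h 0 j + star (h 0 i) * h (Fin.last (m+1)) j +
        ∑ k : Fin m, star (h k.castSucc.succ i) * h k.castSucc.succ j := by
  have hcol : ∀ l : Fin (m+1+1), (hᴴ * J0 (m+1)) i l =
      if l = 0 then star (h (Fin.last (m+1)) i)
      else if l = Fin.last (m+1) then star (h 0 i) else star (h l i) := by
    intro l
    rw [Matrix.mul_apply]
    split_ifs with h0 h1
    · rw [Finset.sum_eq_single (Fin.last (m+1))]
      · simp [J0, h0]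
      · intro k _ hk
        have hk' : k.val ≠ m + 1 := fun e => hk (Fin.ext e)
        have h0' : l.val = 0 := congrArg Fin.val h0
        simp only [J0, Matrix.of_apply, Fin.ext_iff]
        rw [if_neg (by omega), if_neg (by omega), if_neg (by omega), mul_zero]
      · simp
    · rw [Finset.sum_eq_single 0]
      · simp [J0, h1]
      · intro k _ hk
        have hk' : k.val ≠ 0 := fun e => hk (Fin.ext e)
        have h1' : l.val = m + 1 := congrArg Fin.val h1
        simp only [J0, Matrix.of_apply, Fin.ext_iff]
        rw [if_neg (by omega), if_neg (by omega), if_neg (by omega), mul_zero]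
      · simp
    · have h0' : l.val ≠ 0 := fun e => h0 (Fin.ext e)
      have h1' : l.val ≠ m + 1 := fun e => h1 (Fin.ext e)
      have hl := l.isLt
      rw [Finset.sum_eq_single l]
      · rw [J0, Matrix.of_apply, if_neg (by omega), if_neg (by omega), if_pos ⟨rfl, by omega, by omega⟩, mul_one,
          Matrix.conjTranspose_apply]
      · intro k _ hk
        have hk' : k.val ≠ l.val := fun e => hk (Fin.ext e)
        simp only [J0, Matrix.of_apply, Fin.ext_iff]
        rw [if_neg (by omega), if_neg (by omega), if_neg (by omega), mul_zero]
      · simp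
  rw [Matrix.mul_apply, Fin.sum_univ_succ, Fin.sum_univ_castSucc]
  have hne : ∀ k : Fin m, k.castSucc.succ ≠ Fin.last (m+1) := by
    intro k
    rw [Fin.succ_castSucc]
    exact Fin.castSucc_ne_last _
  simp only [hcol, Fin.succ_last, Fin.succ_ne_zero, hne, Nat.succ_eq_add_one,
    (Fin.last_pos (n := m)).ne', if_true, if_false]
  ring

/-- If `h ∈ U(J₀)` swaps the cusps `q_∞ = [e₀]` and `q₀ = [eₙ]` projectively, then all
entries outside the `(0,n)` entry, the `(n,0)` entry, and the middle `(n−1)×(n−1)` block `A`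
vanish, the middle block satisfies `A*A = I`, and `h(0,n) = 1/conj(h(n,0))`. -/
theorem statement_4 (n : ℕ) (hn : 1 ≤ n) (h : Matrix (Fin (n+1)) (Fin (n+1)) ℂ)
    (hinv : IsUnit h) (hJ : hᴴ * J0 n * h = J0 n)
    (hswap0 : ∃ μ : ℂ, h *ᵥ e0 n = μ • eLast n)
    (hswapn : ∃ ν : ℂ, h *ᵥ eLast n = ν • e0 n) :
    (∀ i j : Fin (n+1),
        ¬((i.val = 0 ∧ j.val = n) ∨ (i.val = n ∧ j.val = 0) ∨
          (0 < i.val ∧ i.val < n ∧ 0 < j.val ∧ j.val < n)) → h i j = 0) ∧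
    (Matrix.of fun i j : Fin (n-1) => h (midIdx n i) (midIdx n j))ᴴ *
      (Matrix.of fun i j : Fin (n-1) => h (midIdx n i) (midIdx n j)) = 1 ∧
    h 0 (Fin.last n) = ((starRingEnd ℂ) (h (Fin.last n) 0))⁻¹ := by
  obtain ⟨m, rfl⟩ : ∃ m, n = m + 1 := ⟨n - 1, by omega⟩
  obtain ⟨μ, hμ⟩ := hswap0
  obtain ⟨ν, hν⟩ := hswapn
  have hform : ∀ i j : Fin (m+1+1),
      star (h (Fin.last (m+1)) i) * h 0 j + star (h 0 i) * h (Fin.last (m+1)) j +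
        ∑ k : Fin m, star (h k.castSucc.succ i) * h k.castSucc.succ j = J0 (m+1) i j := by
    intro i j
    rw [← conjTranspose_mul_J0_mul_apply, hJ]
  have hcol0 : ∀ i, i ≠ Fin.last (m+1) → h i 0 = 0 := by
    intro i hi
    simpa [e0, eLast, hi] using congrFun hμ i
  have hcoln : ∀ i, i ≠ 0 → h i (Fin.last (m+1)) = 0 := by
    intro i hi
    simpa [e0, eLast, hi] using congrFun hν i
  have hlast : (0 : Fin (m+1+1)) ≠ Fin.last (m+1) := (Fin.last_pos (n := m)).ne
  have hmid : ∀ k : Fin m, k.castSucc.succ ≠ Fin.last (m+1) := by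
    intro k
    rw [Fin.succ_castSucc]
    exact Fin.castSucc_ne_last _
  have hrow0 : ∀ j, star (h (Fin.last (m+1)) 0) * h 0 j = J0 (m+1) 0 j := by
    intro j
    simpa [hcol0 0 hlast, fun k : Fin m => hcol0 _ (hmid k)] using hform 0 j
  have hrown : ∀ j, star (h 0 (Fin.last (m+1))) * h (Fin.last (m+1)) j =
      J0 (m+1) (Fin.last (m+1)) j := by
    intro j
    simpa [hcoln _ hlast.symm, fun k : Fin m => hcoln _ (Fin.succ_ne_zero k.castSucc)]
      using hform (Fin.last (m+1)) j
  have hprod : star (h (Fin.last (m+1)) 0) * h 0 (Fin.last (m+1)) = 1 := by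
    rw [hrow0]
    simp [J0]
  have hμ0 : star (h (Fin.last (m+1)) 0) ≠ 0 := left_ne_zero_of_mul_eq_one hprod
  have hν0 : star (h 0 (Fin.last (m+1))) ≠ 0 :=
    star_ne_zero.mpr (right_ne_zero_of_mul_eq_one hprod)
  have hzero0 : ∀ j : Fin (m+1+1), j.val ≠ m + 1 → h 0 j = 0 := by
    intro j hj
    refine (mul_eq_zero.mp ((hrow0 j).trans ?_)).resolve_left hμ0
    simp [J0, hj]
  have hzeron : ∀ j : Fin (m+1+1), j.val ≠ 0 → h (Fin.last (m+1)) j = 0 := by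
    intro j hj
    refine (mul_eq_zero.mp ((hrown j).trans ?_)).resolve_left hν0
    simp [J0, Fin.val_ne_zero_iff.mp hj]
  refine ⟨?_, ?_, eq_inv_of_mul_eq_one_right hprod⟩
  · intro i j hij
    have hi := i.isLt
    have hj := j.isLt
    by_cases hi0 : i.val = 0
    · obtain rfl : i = 0 := Fin.ext hi0
      exact hzero0 j (by omega)
    by_cases hin : i.val = m + 1
    · obtain rfl : i = Fin.last (m+1) := Fin.ext hin
      exact hzeron j (by omega)
    by_cases hj0 : j.val = 0
    · obtain rfl : j = 0 := Fin.ext hj0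
      exact hcol0 i fun e => hin (congrArg Fin.val e)
    · obtain rfl : j = Fin.last (m+1) := Fin.ext (by rw [Fin.val_last]; omega)
      exact hcoln i fun e => hi0 (congrArg Fin.val e)
  · ext i j
    have hidx : ∀ k : Fin m, midIdx (m+1) k = k.castSucc.succ := fun _ => rfl
    have key := hform (midIdx (m+1) i) (midIdx (m+1) j)
    have hi : i.val < m := i.isLt
    have hj : j.val < m := j.isLt
    rw [hzero0 (midIdx (m+1) i) (by simp only [midIdx]; omega),
      hzero0 (midIdx (m+1) j) (by simp only [midIdx]; omega), star_zero, mul_zero, zero_mul,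
      zero_add, zero_add] at key
    rw [Matrix.mul_apply]
    refine key.trans ?_
    by_cases hij : i = j
    · subst hij
      simp [J0, midIdx, hi.ne, hi]
    · have hij' : i.val ≠ j.val := fun e => hij (Fin.ext e)
      simp [J0, midIdx, hij, hij']
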